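/- arXiv:0906.2558 — 3 statements merged into one kernel-verified Lean document; each statement's English description precedes it below -/
import Mathlib

section
/- If w, w' ∈ W₀ˢ are standard labeled graphs of finite norm and d(w̃, w̃') = 0, then w̃ = w̃', i.e. w and w' are isomorphic; consequently d is a metric (not merely a pseudometric) on 𝒢₀. -/
open scoped ENNReal
open Filter Topology

/-- Edges: 2-element subsets of the vertex set `ℕ`. -/
abbrev Edge : Type := {e : Sym2 ℕ // ¬ e.IsDiag}

/-- A labeled graph: an assignment of a real weight to each edge. -/
abbrev LGraph : Type := Edge → ℝ

/-- The norm of a labeled graph: the sum of the absolute values of its edge weights. -/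
noncomputable def gnorm (w : LGraph) : ℝ≥0∞ := ∑' e : Edge, ENNReal.ofReal |w e|

/-- A labeled graph has finite norm if its norm is finite. -/
def FiniteNorm (w : LGraph) : Prop := gnorm w ≠ ⊤

/-- The distance between two labeled graphs: `d(w,w') = |w - w'|`. -/
noncomputable def ldist (w w' : LGraph) : ℝ≥0∞ := ∑' e : Edge, ENNReal.ofReal |w e - w' e|

/-- A vertex is isolated if every edge containing it has weight `0`. -/
def Isolated (w : LGraph) (v : ℕ) : Prop := ∀ e : Edge, v ∈ e.val → w e = 0

/-- A labeled graph is standard if it has infinitely many isolated vertices. -/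
def Standard (w : LGraph) : Prop := {v : ℕ | Isolated w v}.Infinite

/-- The image of an edge under a bijection of the vertex set. -/
def mapEdge (f : ℕ ≃ ℕ) (e : Edge) : Edge :=
  ⟨e.val.map f, fun h => e.prop ((Sym2.isDiag_map f.injective).mp h)⟩

/-- Two labeled graphs are isomorphic if some bijection of the vertices carries the
weights of one to the other: `w(uv) = w'(f(u)f(v))` for all edges `uv`. -/
def GIso (w w' : LGraph) : Prop := ∃ f : ℕ ≃ ℕ, ∀ e : Edge, w e = w' (mapEdge f e)

/-- The isomorphism class of a labeled graph (as a set of labeled graphs). -/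
def cls (w : LGraph) : Set LGraph := {w' | GIso w w'}

/-- The distance between the isomorphism classes of two labeled graphs:
`d(G,G') = inf { d(u,v) : u ∈ G, v ∈ G' }`. -/
noncomputable def Gdist (w₁ w₂ : LGraph) : ℝ≥0∞ := ⨅ u ∈ cls w₁, ⨅ v ∈ cls w₂, ldist u v

theorem mapEdge_mapEdge (f g : ℕ ≃ ℕ) (e : Edge) :
    mapEdge g (mapEdge f e) = mapEdge (f.trans g) e := by
  apply Subtype.ext
  simp [mapEdge, Sym2.map_map]

theorem mapEdge_refl (e : Edge) : mapEdge (Equiv.refl ℕ) e = e := by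
  apply Subtype.ext
  simp [mapEdge]

theorem mapEdge_mapEdge_symm (f : ℕ ≃ ℕ) (e : Edge) : mapEdge f (mapEdge f.symm e) = e := by
  rw [mapEdge_mapEdge, Equiv.symm_trans_self, mapEdge_refl]

theorem mapEdge_symm_mapEdge (f : ℕ ≃ ℕ) (e : Edge) : mapEdge f.symm (mapEdge f e) = e := by
  rw [mapEdge_mapEdge, Equiv.self_trans_symm, mapEdge_refl]

theorem mem_mapEdge (f : ℕ ≃ ℕ) {e : Edge} {v : ℕ} (h : v ∈ e.val) :
    f v ∈ (mapEdge f e).val :=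
  Sym2.mem_map.mpr ⟨v, h, rfl⟩

theorem ldist_comp_mapEdge (f : ℕ ≃ ℕ) (u v : LGraph) :
    ldist (u ∘ mapEdge f) (v ∘ mapEdge f) = ldist u v :=
  Equiv.tsum_eq (⟨mapEdge f, mapEdge f.symm, mapEdge_symm_mapEdge f, mapEdge_mapEdge_symm f⟩ :
    Edge ≃ Edge) fun e => ENNReal.ofReal |u e - v e|

theorem ldist_comm (u v : LGraph) : ldist u v = ldist v u := by
  simp only [ldist, abs_sub_comm]

theorem ldist_triangle (u v x : LGraph) : ldist u x ≤ ldist u v + ldist v x := by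
  unfold ldist
  rw [← ENNReal.tsum_add]
  refine ENNReal.tsum_le_tsum fun e => ?_
  rw [← ENNReal.ofReal_add (abs_nonneg _) (abs_nonneg _)]
  exact ENNReal.ofReal_le_ofReal (abs_sub_le _ _ _)

theorem Gdist_eq_iInf_equiv (w w' : LGraph) :
    Gdist w w' = ⨅ f : ℕ ≃ ℕ, ldist w (w' ∘ mapEdge f) := by
  apply le_antisymm
  · refine le_iInf fun f => ?_
    refine iInf₂_le_of_le w ⟨Equiv.refl ℕ, fun e => by rw [mapEdge_refl]⟩ ?_
    refine iInf₂_le_of_le (w' ∘ mapEdge f) ⟨f.symm, fun e => ?_⟩ le_rfl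
    rw [Function.comp_apply, mapEdge_mapEdge_symm]
  · refine le_iInf₂ fun u hu => le_iInf₂ fun v hv => ?_
    obtain ⟨a, ha⟩ := hu
    obtain ⟨b, hb⟩ := hv
    refine iInf_le_of_le (a.trans b.symm) (le_of_eq ?_)
    rw [← ldist_comp_mapEdge a u v]
    congr 1
    · exact funext ha
    · funext e
      rw [Function.comp_apply, hb, ← mapEdge_mapEdge, mapEdge_mapEdge_symm, Function.comp_apply]

theorem Gdist_le_swap (w w' : LGraph) : Gdist w w' ≤ Gdist w' w := by
  rw [Gdist_eq_iInf_equiv w', Gdist_eq_iInf_equiv w]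
  refine le_iInf fun f => iInf_le_of_le f.symm (le_of_eq ?_)
  rw [ldist_comm, ← ldist_comp_mapEdge f]
  congr 1
  funext e
  simp only [Function.comp_apply, mapEdge_symm_mapEdge]

theorem Gdist_comm (w w' : LGraph) : Gdist w w' = Gdist w' w :=
  le_antisymm (Gdist_le_swap w w') (Gdist_le_swap w' w)

theorem Gdist_triangle (w₁ w₂ w₃ : LGraph) : Gdist w₁ w₃ ≤ Gdist w₁ w₂ + Gdist w₂ w₃ := by
  simp only [Gdist_eq_iInf_equiv]
  refine ENNReal.le_iInf_add_iInf fun f g => iInf_le_of_le (f.trans g) ?_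
  refine (ldist_triangle w₁ (w₂ ∘ mapEdge f) _).trans (add_le_add le_rfl (le_of_eq ?_))
  rw [← ldist_comp_mapEdge f w₂]
  congr 1
  funext e
  simp only [Function.comp_apply, mapEdge_mapEdge]

theorem GIso.Gdist_eq_zero {w w' : LGraph} (h : GIso w w') : Gdist w w' = 0 := by
  obtain ⟨f, hf⟩ := h
  rw [Gdist_eq_iInf_equiv]
  refine le_antisymm (iInf_le_of_le f (le_of_eq ?_)) bot_le
  simp [ldist, ← hf]

theorem FiniteNorm.finite_le_abs {w : LGraph} (hw : FiniteNorm w) {c : ℝ} (hc : 0 < c) :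
    {e : Edge | c ≤ |w e|}.Finite := by
  refine (ENNReal.finite_const_le_of_tsum_ne_top hw
    (ENNReal.ofReal_pos.mpr hc).ne').subset fun e he => ?_
  exact ENNReal.ofReal_le_ofReal he

theorem FiniteNorm.finite_vertices_le_abs {w : LGraph} (hw : FiniteNorm w) {c : ℝ}
    (hc : 0 < c) : {v : ℕ | ∃ e : Edge, c ≤ |w e| ∧ v ∈ e.val}.Finite := by
  refine ((hw.finite_le_abs hc).biUnion (t := fun e => {v | v ∈ e.val}) fun e _ => ?_).subset ?_
  · obtain ⟨e, -⟩ := e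
    induction e with
    | h x y => exact (Set.toFinite {x, y}).subset fun v hv => by simpa using hv
  · rintro v ⟨e, he, hv⟩
    exact Set.mem_biUnion he hv

/-- Along a sequence of bijections that almost carry `w` to `w'`, the image of a non-isolated
vertex is constant on a set of the ultrafilter, and the constant is non-isolated. -/
theorem exists_eventually_eq_of_not_isolated {w w' : LGraph} (hw' : FiniteNorm w')
    (F : ℕ → ℕ ≃ ℕ) (hF : ∀ e, Tendsto (fun n => w' (mapEdge (F n) e)) atTop (𝓝 (w e)))
    {v : ℕ} (hv : ¬ Isolated w v) :
    ∃ k, ¬ Isolated w' k ∧ ∀ᶠ n in (hyperfilter ℕ : Filter ℕ), F n v = k := by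
  simp only [Isolated, not_forall] at hv
  obtain ⟨e, hve, he⟩ := hv
  have hc : 0 < |w e| / 2 := by positivity
  have hev : ∀ᶠ n in (hyperfilter ℕ : Filter ℕ), |w e| / 2 < |w' (mapEdge (F n) e)| :=
    Nat.hyperfilter_le_atTop
      ((hF e).abs.eventually (lt_mem_nhds (half_lt_self (abs_pos.mpr he))))
  have hmem : ∀ᶠ n in (hyperfilter ℕ : Filter ℕ),
      ∃ k ∈ {v : ℕ | ∃ e' : Edge, |w e| / 2 ≤ |w' e'| ∧ v ∈ e'.val}, F n v = k := by
    filter_upwards [hev] with n hn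
    exact ⟨F n v, ⟨_, hn.le, mem_mapEdge (F n) hve⟩, rfl⟩
  obtain ⟨k, -, hk⟩ :=
    (Ultrafilter.eventually_exists_mem_iff (P := fun k n => F n v = k)
      (hw'.finite_vertices_le_abs hc)).mp hmem
  refine ⟨k, fun hiso => ?_, hk⟩
  obtain ⟨n, hn, rfl⟩ := (hev.and hk).exists
  rw [hiso _ (mem_mapEdge (F n) hve), abs_zero] at hn
  exact lt_asymm hc hn

theorem exists_equiv_abs_sub_le {w w' : LGraph} (h : Gdist w w' = 0) {ε : ℝ} (hε : 0 < ε) :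
    ∃ f : ℕ ≃ ℕ, ∀ e, |w e - w' (mapEdge f e)| ≤ ε := by
  have hlt : Gdist w w' < ENNReal.ofReal ε := by
    rw [h]
    exact ENNReal.ofReal_pos.mpr hε
  rw [Gdist_eq_iInf_equiv] at hlt
  obtain ⟨f, hf⟩ := iInf_lt_iff.mp hlt
  refine ⟨f, fun e => (ENNReal.ofReal_le_ofReal_iff hε.le).mp (le_trans ?_ hf.le)⟩
  exact ENNReal.le_tsum (f := fun e => ENNReal.ofReal |w e - (w' ∘ mapEdge f) e|) e

/-- A weight-preserving bijection between the non-isolated vertices of two standard labeled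
graphs extends to an isomorphism. -/
theorem GIso.of_nonisolated_equiv {w w' : LGraph} (hw : Standard w) (hw' : Standard w')
    (φ : {v // ¬ Isolated w v} ≃ {v // ¬ Isolated w' v})
    (hφ : ∀ (g : ℕ ≃ ℕ) (e : Edge),
      (∀ v ∈ e.val, ∃ h : ¬ Isolated w v, g v = φ ⟨v, h⟩) → w e = w' (mapEdge g e)) :
    GIso w w' := by
  classical
  have : Infinite {v // Isolated w v} := hw.to_subtype
  have : Infinite {v // Isolated w' v} := hw'.to_subtype
  obtain ⟨ψ⟩ : Nonempty ({v // Isolated w v} ≃ {v // Isolated w' v}) :=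
    nonempty_equiv_of_countable
  refine ⟨Equiv.subtypeCongr ψ φ, fun e => ?_⟩
  by_cases he : ∃ v ∈ e.val, Isolated w v
  · obtain ⟨v, hve, hv⟩ := he
    have hmem := mem_mapEdge (Equiv.subtypeCongr ψ φ) hve
    have hval : Equiv.subtypeCongr ψ φ v = ψ ⟨v, hv⟩ := by simp [Equiv.subtypeCongr, hv]
    rw [hval] at hmem
    rw [hv e hve, (ψ ⟨v, hv⟩).2 _ hmem]
  · push Not at he
    exact hφ _ e fun v hve => ⟨he v hve, by simp [Equiv.subtypeCongr, he v hve]⟩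

theorem GIso.of_Gdist_eq_zero {w w' : LGraph} (hw : Standard w) (hfin : FiniteNorm w)
    (hw' : Standard w') (hfin' : FiniteNorm w') (h : Gdist w w' = 0) : GIso w w' := by
  choose F hF using fun n : ℕ =>
    exists_equiv_abs_sub_le h (Nat.one_div_pos_of_nat (α := ℝ) (n := n))
  have hlim (e : Edge) : Tendsto (fun n => w' (mapEdge (F n) e)) atTop (𝓝 (w e)) :=
    tendsto_iff_dist_tendsto_zero.mpr <| squeeze_zero (fun _ => dist_nonneg)
      (fun n => by rw [dist_comm, Real.dist_eq]; exact hF n e)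
      tendsto_one_div_add_atTop_nhds_zero_nat
  have hlim_symm (e : Edge) :
      Tendsto (fun n => w (mapEdge (F n).symm e)) atTop (𝓝 (w' e)) :=
    tendsto_iff_dist_tendsto_zero.mpr <| squeeze_zero (fun _ => dist_nonneg)
      (fun n => by
        have := hF n (mapEdge (F n).symm e)
        rwa [mapEdge_mapEdge_symm, ← Real.dist_eq] at this)
      tendsto_one_div_add_atTop_nhds_zero_nat
  choose f hf hfF using fun v : {v // ¬ Isolated w v} =>
    exists_eventually_eq_of_not_isolated hfin' F hlim v.2
  choose g hg hgF using fun v : {v // ¬ Isolated w' v} =>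
    exists_eventually_eq_of_not_isolated hfin (fun n => (F n).symm) hlim_symm v.2
  refine GIso.of_nonisolated_equiv hw hw'
    ⟨fun v => ⟨f v, hf v⟩, fun v => ⟨g v, hg v⟩, fun v => ?_, fun v => ?_⟩ ?_
  · obtain ⟨n, h₁, h₂⟩ := ((hfF v).and (hgF ⟨f v, hf v⟩)).exists
    apply Subtype.ext
    exact h₂.symm.trans ((F n).symm_apply_eq.mpr h₁.symm)
  · obtain ⟨n, h₁, h₂⟩ := ((hgF v).and (hfF ⟨g v, hg v⟩)).exists
    apply Subtype.ext
    exact h₂.symm.trans ((F n).symm_apply_eq.mp h₁).symm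
  · rintro σ e he
    refine tendsto_nhds_unique ((hlim e).mono_left Nat.hyperfilter_le_atTop)
      (tendsto_const_nhds.congr' ?_)
    obtain ⟨⟨x, y⟩, hxy⟩ := e
    obtain ⟨hx, hσx⟩ := he x (Sym2.mem_mk_left x y)
    obtain ⟨hy, hσy⟩ := he y (Sym2.mem_mk_right x y)
    filter_upwards [hfF ⟨x, hx⟩, hfF ⟨y, hy⟩] with n hnx hny
    congr 1
    apply Subtype.ext
    change s(σ x, σ y) = s(F n x, F n y)
    rw [hσx, hσy, hnx, hny]
    rfl

/-- If two standard labeled graphs of finite norm have isomorphism classes at distance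
`0`, then they are isomorphic; consequently `d` is a metric (not merely a pseudometric)
on `𝒢₀`. -/
theorem Gdist_eq_zero_iff_iso :
    (∀ w w' : LGraph, Standard w → FiniteNorm w → Standard w' → FiniteNorm w' →
      Gdist w w' = 0 → GIso w w') ∧
    (∀ w : LGraph, Standard w → FiniteNorm w → Gdist w w = 0) ∧
    (∀ w w' : LGraph, Standard w → FiniteNorm w → Standard w' → FiniteNorm w' →
      Gdist w w' = Gdist w' w) ∧
    (∀ w₁ w₂ w₃ : LGraph, Standard w₁ → FiniteNorm w₁ → Standard w₂ → FiniteNorm w₂ →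
      Standard w₃ → FiniteNorm w₃ → Gdist w₁ w₃ ≤ Gdist w₁ w₂ + Gdist w₂ w₃) ∧
    (∀ w w' : LGraph, Standard w → FiniteNorm w → Standard w' → FiniteNorm w' →
      (Gdist w w' = 0 ↔ GIso w w')) := by
  have eq_zero_iff (w w' : LGraph) (hw : Standard w) (hfin : FiniteNorm w)
      (hw' : Standard w') (hfin' : FiniteNorm w') : Gdist w w' = 0 ↔ GIso w w' :=
    ⟨GIso.of_Gdist_eq_zero hw hfin hw' hfin', GIso.Gdist_eq_zero⟩
  refine ⟨fun w w' hw hfin hw' hfin' => (eq_zero_iff w w' hw hfin hw' hfin').mp,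
    fun w _ _ => GIso.Gdist_eq_zero ⟨Equiv.refl ℕ, fun e => by rw [mapEdge_refl]⟩,
    fun w w' _ _ _ _ => Gdist_comm w w',
    fun w₁ w₂ w₃ _ _ _ _ _ _ => Gdist_triangle w₁ w₂ w₃, eq_zero_iff⟩
end

section
/- Any sequence that is increasing and bounded above with respect to the subgraph order ⪯ is convergent: (a) if w₁ ⪯ w₂ ⪯ … in W₀ and there is u ∈ W₀ with wₙ ⪯ u for all n, then {wₙ} converges in (W₀, d); (b) if G₁ ⪯ G₂ ⪯ … in 𝒢₀ and there is H ∈ 𝒢₀ with Gₙ ⪯ H for all n, then {Gₙ} converges in (𝒢₀, d). -/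
open scoped ENNReal
open Filter Topology

/-- `w ⪯ w'` for labeled graphs: every edge weight of `w` is `0` or agrees with `w'`. -/
def LSub (w w' : LGraph) : Prop := ∀ e : Edge, w e = 0 ∨ w e = w' e

/-- The subgraph relation on unlabeled graphs: some representatives are in the
labeled subgraph relation. -/
def GSub (w w' : LGraph) : Prop := ∃ u ∈ cls w, ∃ v ∈ cls w', LSub u v

/-- The permutation of the edges induced by a permutation of the vertices. -/
def edgePerm (f : ℕ ≃ ℕ) : Edge ≃ Edge where
  toFun := mapEdge f
  invFun := mapEdge f.symm
  left_inv e := Subtype.ext <| by simp [mapEdge, Sym2.map_map]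
  right_inv e := Subtype.ext <| by simp [mapEdge, Sym2.map_map]

/-- Relabeling of the vertices of a labeled graph. -/
def relabel (f : ℕ ≃ ℕ) (w : LGraph) : LGraph := fun e => w (mapEdge f e)

theorem relabel_relabel (f k : ℕ ≃ ℕ) (w : LGraph) :
    relabel f (relabel k w) = relabel (f.trans k) w := by
  funext e
  simp [relabel, mapEdge, Sym2.map_map]

theorem relabel_refl (w : LGraph) : relabel (Equiv.refl ℕ) w = w := by
  funext e
  simp [relabel, mapEdge]

theorem self_mem_cls (w : LGraph) : w ∈ cls w :=
  ⟨Equiv.refl ℕ, fun e => (congrFun (relabel_refl w) e).symm⟩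

theorem relabel_mem_cls (f : ℕ ≃ ℕ) (w : LGraph) : relabel f w ∈ cls w := by
  refine ⟨f.symm, fun e => ?_⟩
  change w e = relabel f.symm (relabel f w) e
  rw [relabel_relabel, Equiv.symm_trans_self, relabel_refl]

theorem ldist_relabel (f : ℕ ≃ ℕ) (w w' : LGraph) :
    ldist (relabel f w) (relabel f w') = ldist w w' :=
  (edgePerm f).tsum_eq fun e => ENNReal.ofReal |w e - w' e|

theorem gnorm_relabel (f : ℕ ≃ ℕ) (w : LGraph) : gnorm (relabel f w) = gnorm w :=
  (edgePerm f).tsum_eq fun e => ENNReal.ofReal |w e|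

theorem ldist_triangle_s10 (a b c : LGraph) : ldist a c ≤ ldist a b + ldist b c := by
  unfold ldist
  rw [← ENNReal.tsum_add]
  refine ENNReal.tsum_le_tsum fun e => ?_
  rw [← ENNReal.ofReal_add (abs_nonneg _) (abs_nonneg _)]
  exact ENNReal.ofReal_le_ofReal (abs_sub_le _ _ _)

theorem Gdist_le_ldist_relabel (f : ℕ ≃ ℕ) (w w' : LGraph) :
    Gdist w w' ≤ ldist (relabel f w) w' :=
  iInf₂_le_of_le _ (relabel_mem_cls f w) <| iInf₂_le _ (self_mem_cls w')

namespace LSub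

variable {a b c : LGraph}

theorem relabel (h : LSub a b) (f : ℕ ≃ ℕ) : LSub (relabel f a) (relabel f b) :=
  fun e => h (mapEdge f e)

theorem refl (a : LGraph) : LSub a a := fun _ => Or.inr rfl

theorem trans (h : LSub a b) (h' : LSub b c) : LSub a c := by
  intro e
  rcases h e with h | h
  · exact Or.inl h
  · rw [h]
    exact h' e

theorem abs_le (h : LSub a b) (e : Edge) : |a e| ≤ |b e| := by
  rcases h e with h | h <;> simp [h]

theorem gnorm_le (h : LSub a b) : gnorm a ≤ gnorm b :=
  ENNReal.tsum_le_tsum fun e => ENNReal.ofReal_le_ofReal (h.abs_le e)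

theorem ldist_add_gnorm (h : LSub a b) : ldist a b + gnorm a = gnorm b := by
  unfold ldist gnorm
  rw [← ENNReal.tsum_add]
  congr 1
  funext e
  rcases h e with h | h <;> simp [h]

theorem of_le_succ {g : ℕ → LGraph} (h : ∀ n, LSub (g n) (g (n + 1))) {m n : ℕ}
    (hmn : m ≤ n) : LSub (g m) (g n) := by
  induction n, hmn using Nat.le_induction with
  | base => exact refl _
  | succ n _ ih => exact ih.trans (h n)

end LSub

theorem GSub.exists_relabel {a b : LGraph} (h : GSub a b) :
    ∃ f : ℕ ≃ ℕ, LSub a (relabel f b) := by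
  obtain ⟨u, ⟨f, hf⟩, v, ⟨k, hk⟩, huv⟩ := h
  refine ⟨f.trans k.symm, ?_⟩
  obtain rfl : a = relabel f u := funext hf
  obtain rfl : b = relabel k v := funext hk
  rw [relabel_relabel, Equiv.trans_assoc, Equiv.symm_trans_self, Equiv.trans_refl]
  exact huv.relabel f

theorem FiniteNorm.mono {w u : LGraph} (hu : FiniteNorm u) (h : ∀ e, |w e| ≤ |u e|) :
    FiniteNorm w :=
  ne_top_of_le_ne_top hu <| ENNReal.tsum_le_tsum fun e => ENNReal.ofReal_le_ofReal (h e)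

theorem Standard.mono {w u : LGraph} (hu : Standard u) (h : ∀ e, |w e| ≤ |u e|) :
    Standard w :=
  Set.Infinite.mono (s := {v | Isolated u v}) (fun v hv e he => abs_eq_zero.mp <|
    le_antisymm ((h e).trans (by simp [hv e he])) (abs_nonneg _)) hu

/-- Dominated convergence for labeled graphs. -/
theorem tendsto_ldist_of_dominated {x : ℕ → LGraph} {w u : LGraph} (hu : FiniteNorm u)
    (hx : ∀ n e, |x n e| ≤ |u e|) (hw : ∀ e, |w e| ≤ |u e|)
    (hlim : ∀ e, Tendsto (fun n => x n e) atTop (𝓝 (w e))) :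
    Tendsto (fun n => ldist (x n) w) atTop (𝓝 0) := by
  let _ : MeasurableSpace Edge := ⊤
  have key := MeasureTheory.tendsto_lintegral_of_dominated_convergence
    (μ := MeasureTheory.Measure.count)
    (F := fun n e => ENNReal.ofReal |x n e - w e|) (f := fun _ : Edge => 0)
    (fun e => 2 * ENNReal.ofReal |u e|) (fun n => measurable_from_top)
    (fun n => Eventually.of_forall fun e => ?_) ?_ (Eventually.of_forall fun e => ?_)
  · simpa [MeasureTheory.lintegral_count, ldist] using key
  · dsimp only
    rw [two_mul, ← ENNReal.ofReal_add (abs_nonneg _) (abs_nonneg _)]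
    exact ENNReal.ofReal_le_ofReal ((abs_sub _ _).trans (add_le_add (hx n e) (hw e)))
  · rw [MeasureTheory.lintegral_count, ENNReal.tsum_mul_left]
    exact ENNReal.mul_ne_top (by simp) hu
  · have := ((hlim e).sub_const (w e)).abs
    simpa using ENNReal.tendsto_ofReal this

theorem exists_tendsto_of_LSub_bounded {g : ℕ → LGraph} (hg : ∀ n, LSub (g n) (g (n + 1)))
    {u : LGraph} (hu : FiniteNorm u) (hgu : ∀ n, LSub (g n) u) :
    ∃ w : LGraph, FiniteNorm w ∧ Tendsto (fun n => ldist (g n) w) atTop (𝓝 0) := by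
  have hlim (e : Edge) : ∃ c, |c| ≤ |u e| ∧ Tendsto (fun n => g n e) atTop (𝓝 c) := by
    by_cases h : ∀ n, g n e = 0
    · exact ⟨0, by simp, by simp [h]⟩
    · push Not at h
      obtain ⟨m, hm⟩ := h
      refine ⟨g m e, (hgu m).abs_le e, tendsto_const_nhds.congr' ?_⟩
      filter_upwards [eventually_ge_atTop m] with n hn
      exact (LSub.of_le_succ hg hn e).resolve_left hm
  choose w hwu hw using hlim
  exact ⟨w, hu.mono hwu,
    tendsto_ldist_of_dominated hu (fun n => (hgu n).abs_le) hwu hw⟩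

theorem exists_subseq_tendsto_ldist {x : ℕ → LGraph} {u : LGraph} (hu : FiniteNorm u)
    (hx : ∀ n e, |x n e| ≤ |u e|) :
    ∃ w : LGraph, (∀ e, |w e| ≤ |u e|) ∧ ∃ φ : ℕ → ℕ, StrictMono φ ∧
      Tendsto (fun n => ldist (x (φ n)) w) atTop (𝓝 0) := by
  have hcpt : IsCompact (Set.univ.pi fun e : Edge => Set.Icc (-|u e|) |u e|) :=
    isCompact_univ_pi fun e => isCompact_Icc
  obtain ⟨w, hw, φ, hφ, hlim⟩ :=
    hcpt.tendsto_subseq (x := x) fun n e _ => abs_le.mp (hx n e)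
  have hwu (e : Edge) : |w e| ≤ |u e| := abs_le.mpr (hw e trivial)
  exact ⟨w, hwu, φ, hφ,
    tendsto_ldist_of_dominated hu (fun n => hx (φ n)) hwu (tendsto_pi_nhds.mp hlim)⟩

theorem exists_relabel_monotone {g : ℕ → LGraph} (hg : ∀ n, GSub (g n) (g (n + 1))) :
    ∃ τ : ℕ → ℕ ≃ ℕ, ∀ n, LSub (relabel (τ n) (g n)) (relabel (τ (n + 1)) (g (n + 1))) := by
  choose k hk using fun n => (hg n).exists_relabel
  refine ⟨fun n => Nat.rec (Equiv.refl ℕ) (fun n f => f.trans (k n)) n, fun n => ?_⟩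
  simpa only [relabel_relabel] using (hk n).relabel _

/-- In a chain of labeled graphs with bounded norms, the distance from the `n`-th term to
any later term tends to zero. -/
theorem tendsto_ldist_subseq_of_bounded {x : ℕ → LGraph} (hx : ∀ n, LSub (x n) (x (n + 1)))
    {C : ℝ≥0∞} (hC : C ≠ ⊤) (hxC : ∀ n, gnorm (x n) ≤ C) {φ : ℕ → ℕ} (hφ : StrictMono φ) :
    Tendsto (fun n => ldist (x n) (x (φ n))) atTop (𝓝 0) := by
  have hlim := tendsto_atTop_iSup fun m n (h : m ≤ n) => (LSub.of_le_succ hx h).gnorm_le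
  have htop : ⨆ n, gnorm (x n) ≠ ⊤ := ne_top_of_le_ne_top hC (iSup_le hxC)
  have hsub := ENNReal.Tendsto.sub (hlim.comp hφ.tendsto_atTop) hlim (Or.inl htop)
  rw [tsub_self] at hsub
  refine hsub.congr fun n => ?_
  rw [Function.comp_apply, ← (LSub.of_le_succ hx (hφ.id_le n)).ldist_add_gnorm]
  exact ENNReal.add_sub_cancel_right (ne_top_of_le_ne_top hC (hxC n))

theorem exists_tendsto_of_GSub_bounded {g : ℕ → LGraph} (hg : ∀ n, GSub (g n) (g (n + 1)))
    {u : LGraph} (hs : Standard u) (hu : FiniteNorm u) (hgu : ∀ n, GSub (g n) u) :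
    ∃ w : LGraph, Standard w ∧ FiniteNorm w ∧
      Tendsto (fun n => Gdist (g n) w) atTop (𝓝 0) := by
  choose k hk using fun n => (hgu n).exists_relabel
  have hle (n : ℕ) : LSub (relabel (k n).symm (g n)) u := by
    simpa only [relabel_relabel, Equiv.symm_trans_self, relabel_refl]
      using (hk n).relabel (k n).symm
  obtain ⟨τ, hτ⟩ := exists_relabel_monotone hg
  obtain ⟨w, hwu, φ, hφ, hlim⟩ := exists_subseq_tendsto_ldist hu fun n => (hle n).abs_le
  have hbound (n : ℕ) : gnorm (relabel (τ n) (g n)) ≤ gnorm u := by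
    rw [gnorm_relabel, ← gnorm_relabel (k n).symm]
    exact (hle n).gnorm_le
  refine ⟨w, hs.mono hwu, hu.mono hwu, ?_⟩
  have hsum := (tendsto_ldist_subseq_of_bounded hτ hu hbound hφ).add hlim
  rw [add_zero] at hsum
  refine tendsto_of_tendsto_of_tendsto_of_le_of_le tendsto_const_nhds hsum
    (fun _ => zero_le) fun n => ?_
  let ρ : ℕ ≃ ℕ := (k (φ n)).symm.trans (τ (φ n)).symm
  have hρ : relabel ρ (relabel (τ (φ n)) (g (φ n))) = relabel (k (φ n)).symm (g (φ n)) := by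
    rw [relabel_relabel, Equiv.trans_assoc, Equiv.symm_trans_self, Equiv.trans_refl]
  calc Gdist (g n) w ≤ ldist (relabel ρ (relabel (τ n) (g n))) w := by
        rw [relabel_relabel]
        exact Gdist_le_ldist_relabel _ _ _
    _ ≤ ldist (relabel ρ (relabel (τ n) (g n))) (relabel (k (φ n)).symm (g (φ n)))
          + ldist (relabel (k (φ n)).symm (g (φ n))) w := ldist_triangle_s10 _ _ _
    _ = _ := by rw [← hρ, ldist_relabel]

/-- Any increasing sequence, bounded above with respect to the subgraph order,
converges: (a) in `W₀`; (b) in `𝒢₀`. -/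
theorem increasing_bounded_converges :
    (∀ (g : ℕ → LGraph), (∀ n, FiniteNorm (g n)) → (∀ n, LSub (g n) (g (n + 1))) →
      ∀ u : LGraph, FiniteNorm u → (∀ n, LSub (g n) u) →
      ∃ w : LGraph, FiniteNorm w ∧
        Filter.Tendsto (fun n => ldist (g n) w) Filter.atTop (𝓝 0)) ∧
    (∀ (g : ℕ → LGraph), (∀ n, Standard (g n) ∧ FiniteNorm (g n)) →
      (∀ n, GSub (g n) (g (n + 1))) →
      ∀ u : LGraph, Standard u → FiniteNorm u → (∀ n, GSub (g n) u) →
      ∃ w : LGraph, Standard w ∧ FiniteNorm w ∧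
        Filter.Tendsto (fun n => Gdist (g n) w) Filter.atTop (𝓝 0)) := by
  exact ⟨fun g _ hg u hu hgu => exists_tendsto_of_LSub_bounded hg hu hgu,
    fun g _ hg u hs hu hgu => exists_tendsto_of_GSub_bounded hg hs hu hgu⟩
end

section
/- The metric space (𝒢₀, d) is not locally compact; in particular, the point 0 (the class of the all-zero graph) has no compact neighborhood: for every r > 0 the closed ball of radius r around 0 is not compact. -/
open scoped ENNReal
open Filter Topology

/-- A bijection of the vertices induces a bijection of the edges. -/
def edgeEquiv (f : ℕ ≃ ℕ) : Edge ≃ Edge where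
  toFun := mapEdge f
  invFun := mapEdge f.symm
  left_inv e := Subtype.ext (by simp [mapEdge, Sym2.map_map])
  right_inv e := Subtype.ext (by simp [mapEdge, Sym2.map_map])

theorem GIso.refl (w : LGraph) : GIso w w :=
  ⟨Equiv.refl ℕ, fun e => congrArg w (Subtype.ext (by simp [mapEdge]))⟩

theorem GIso.gnorm_eq {w w' : LGraph} (h : GIso w w') : gnorm w = gnorm w' := by
  obtain ⟨f, hf⟩ := h
  unfold gnorm
  rw [← (edgeEquiv f).tsum_eq (fun e => ENNReal.ofReal |w' e|)]
  exact tsum_congr fun e => by rw [hf e]; rfl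

theorem GIso.exists_eq {w w' : LGraph} (h : GIso w w') (e : Edge) : ∃ e', w' e = w e' := by
  obtain ⟨f, hf⟩ := h
  refine ⟨(edgeEquiv f).symm e, ?_⟩
  rw [hf]
  exact congrArg w' ((edgeEquiv f).apply_symm_apply e).symm

theorem Gdist_le_ldist (w w' : LGraph) : Gdist w w' ≤ ldist w w' :=
  (iInf₂_le w (GIso.refl w)).trans (iInf₂_le w' (GIso.refl w'))

theorem ldist_zero (w : LGraph) : ldist w 0 = gnorm w := by
  simp [ldist, gnorm]

theorem gnorm_le_Gdist_zero (w : LGraph) : gnorm w ≤ Gdist w 0 := by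
  refine le_iInf₂ fun w' hw' => le_iInf₂ fun v hv => ?_
  have hv0 : v = 0 := funext fun e => by
    obtain ⟨e', he'⟩ := GIso.exists_eq hv e
    simpa using he'
  rw [hv0, ldist_zero, GIso.gnorm_eq hw']

/-- The sup norm is 1-Lipschitz for the distance between isomorphism classes. -/
theorem ofReal_abs_le_add_Gdist {w u : LGraph} {c : ℝ} (hw : ∀ e, |w e| ≤ c) (e : Edge) :
    ENNReal.ofReal |u e| ≤ ENNReal.ofReal c + Gdist w u := by
  rw [← tsub_le_iff_left]
  refine le_iInf₂ fun w' hw' => le_iInf₂ fun v hv => ?_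
  rw [tsub_le_iff_left]
  obtain ⟨f, hf⟩ := hv
  obtain ⟨e', he'⟩ := GIso.exists_eq hw' (mapEdge f e)
  have hle : |u e| ≤ c + |w' (mapEdge f e) - v (mapEdge f e)| := by
    rw [hf e]
    have h₁ := hw e'
    rw [← he'] at h₁
    have h₂ := abs_sub_abs_le_abs_sub (v (mapEdge f e)) (w' (mapEdge f e))
    rw [abs_sub_comm] at h₂
    linarith
  calc ENNReal.ofReal |u e|
      ≤ ENNReal.ofReal (c + |w' (mapEdge f e) - v (mapEdge f e)|) := ENNReal.ofReal_le_ofReal hle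
    _ ≤ ENNReal.ofReal c + ENNReal.ofReal |w' (mapEdge f e) - v (mapEdge f e)| :=
        ENNReal.ofReal_add_le
    _ ≤ ENNReal.ofReal c + ldist w' v := by
        gcongr
        exact ENNReal.le_tsum (f := fun e => ENNReal.ofReal |w' e - v e|) (mapEdge f e)

/-- The edges of the infinite star centered at `0`. -/
def starEdge : ℕ ↪ Edge where
  toFun i := ⟨s(0, i + 1), by simp⟩
  inj' i j h := by simpa using congrArg Subtype.val h

/-- The star with `n + 1` edges of equal weight and total weight `r`. -/
noncomputable def starGraph (r : ℝ) (n : ℕ) : LGraph := fun e =>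
  if e ∈ (Finset.range (n + 1)).map starEdge then r / (n + 1) else 0

theorem abs_starGraph_le {r : ℝ} (hr : 0 ≤ r) (n : ℕ) (e : Edge) :
    |starGraph r n e| ≤ r / (n + 1) := by
  have h : 0 ≤ r / ((n : ℝ) + 1) := by positivity
  unfold starGraph
  split_ifs
  · rw [abs_of_nonneg h]
  · simpa using h

theorem gnorm_starGraph {r : ℝ} (hr : 0 ≤ r) (n : ℕ) :
    gnorm (starGraph r n) = ENNReal.ofReal r := by
  have h : 0 ≤ r / ((n : ℝ) + 1) := by positivity
  unfold gnorm
  rw [tsum_eq_sum (s := (Finset.range (n + 1)).map starEdge)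
    (fun e he => by simp only [starGraph, if_neg he, abs_zero, ENNReal.ofReal_zero]),
    Finset.sum_congr rfl (g := fun _ => ENNReal.ofReal (r / (n + 1)))
    (fun e he => by simp only [starGraph, if_pos he, abs_of_nonneg h])]
  rw [Finset.sum_const, Finset.card_map, Finset.card_range, ← ENNReal.ofReal_nsmul, nsmul_eq_mul]
  congr 1
  push_cast
  field_simp

theorem standard_starGraph (r : ℝ) (n : ℕ) : Standard (starGraph r n) := by
  refine (Set.Ioi_infinite (n + 1)).mono fun v hv e he => if_neg fun hmem => ?_
  obtain ⟨i, hi, rfl⟩ := Finset.mem_map.mp hmem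
  have hv' : n + 1 < v := hv
  have hi' := Finset.mem_range.mp hi
  rcases Sym2.mem_iff.mp he with h | h <;> omega

/-- `𝒢₀` is not locally compact: for every `r > 0`, the closed ball of radius `r`
around `0` is not (sequentially) compact. -/
theorem G0_not_locallyCompact (r : ℝ) (hr : 0 < r) :
    ∃ g : ℕ → LGraph,
      (∀ n, Standard (g n) ∧ FiniteNorm (g n) ∧ Gdist (g n) 0 ≤ ENNReal.ofReal r) ∧
      ∀ u : LGraph, Standard u → FiniteNorm u → Gdist u 0 ≤ ENNReal.ofReal r →
        ∀ φ : ℕ → ℕ, StrictMono φ →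
          ¬ Filter.Tendsto (fun n => Gdist (g (φ n)) u) Filter.atTop (𝓝 0) := by
  refine ⟨starGraph r, fun n => ⟨standard_starGraph r n, ?_, ?_⟩, fun u _ _ _ φ hφ hlim => ?_⟩
  · rw [FiniteNorm, gnorm_starGraph hr.le]
    exact ENNReal.ofReal_ne_top
  · exact (Gdist_le_ldist _ _).trans (by rw [ldist_zero, gnorm_starGraph hr.le])
  have hu : u = 0 := funext fun e => by
    have hc : Tendsto (fun n => ENNReal.ofReal (r / ((φ n : ℝ) + 1))) atTop (𝓝 0) := by
      have h := tendsto_const_div_atTop_nhds_zero_nat r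
      have h' := ((tendsto_add_atTop_iff_nat 1).mpr h).comp hφ.tendsto_atTop
      simpa [Function.comp_def] using ENNReal.tendsto_ofReal h'
    have hle := ge_of_tendsto' (hc.add hlim) fun n =>
      ofReal_abs_le_add_Gdist (abs_starGraph_le hr.le (φ n)) e
    simpa using hle
  subst hu
  have hle := ge_of_tendsto' hlim fun n =>
    (gnorm_starGraph hr.le (φ n)).symm.le.trans (gnorm_le_Gdist_zero _)
  exact (ENNReal.ofReal_pos.mpr hr).not_ge hle
end
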